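/- Let Λ be a ring and M an indecomposable Λ-module of finite length at least 2. Then M has a Gabriel–Roiter submodule: there exists an indecomposable proper submodule T of M such that μ(M) = μ(T) ∪ {|M|}. -/

import Mathlib

/-- The Gabriel–Roiter total order on sets of natural numbers: `I ≺ J` iff
`I ≠ J` and the least element of the symmetric difference belongs to `J`.
(All sets occurring as Gabriel–Roiter measures consist of positive integers.) -/
def GRlt (I J : Set ℕ) : Prop :=
  I ≠ J ∧ ∃ m ∈ (I \ J) ∪ (J \ I), (∀ k ∈ (I \ J) ∪ (J \ I), m ≤ k) ∧ m ∈ J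

/-- `I ≼ J` iff `I = J` or `I ≺ J`. -/
def GRle (I J : Set ℕ) : Prop := I = J ∨ GRlt I J

/-- A module is indecomposable if it is nonzero and is not the internal direct
sum of two nonzero submodules. -/
def IsIndecomposableModule (Λ : Type*) [Ring Λ] (M : Type*) [AddCommGroup M]
    [Module Λ M] : Prop :=
  (⊤ : Submodule Λ M) ≠ ⊥ ∧
    ¬ ∃ A B : Submodule Λ M, A ≠ ⊥ ∧ B ≠ ⊥ ∧ IsCompl A B

open Classical in
/-- The (composition series) length `|M|` of a finite length module `M`,
defined via a composition series from `⊥` to `⊤` (any two such have the same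
length by the Jordan–Hölder theorem); it is `0` if no such series exists. -/
noncomputable def mlen (Λ : Type*) [Ring Λ] (M : Type*) [AddCommGroup M]
    [Module Λ M] : ℕ :=
  if h : ∃ s : CompositionSeries (Submodule Λ M), s.head = ⊥ ∧ s.last = ⊤ then
    h.choose.length
  else 0

/-- The collection of subsets of `ℕ` of the form `{|M₁|, …, |M_t|}` where
`M₁ ⊂ M₂ ⊂ ⋯ ⊂ M_t` ranges over (finite, nonempty) chains of indecomposable
submodules of `M`. -/
def grChainSets (Λ : Type*) [Ring Λ] (M : Type*) [AddCommGroup M]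
    [Module Λ M] : Set (Set ℕ) :=
  { S | ∃ (t : ℕ) (c : Fin (t + 1) → Submodule Λ M), StrictMono c ∧
      (∀ i, IsIndecomposableModule Λ (c i)) ∧
      S = Set.range fun i => mlen Λ (c i) }

open Classical in
/-- The Gabriel–Roiter measure `μ(M)`: the maximum, with respect to the total
order `≺`, of the sets of lengths of chains of indecomposable submodules of
`M` (and `∅` if this maximum does not exist, e.g. for `M = 0`). -/
noncomputable def grMeasure (Λ : Type*) [Ring Λ] (M : Type*) [AddCommGroup M]
    [Module Λ M] : Set ℕ :=
  if h : ∃ S, S ∈ grChainSets Λ M ∧ ∀ S' ∈ grChainSets Λ M, GRle S' S then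
    h.choose
  else ∅

theorem grlt_iff {I J : Set ℕ} :
    GRlt I J ↔ ∃ m ∈ J, m ∉ I ∧ ∀ k < m, k ∈ I ↔ k ∈ J := by
  constructor
  · rintro ⟨-, m, hm, hmin, hmJ⟩
    refine ⟨m, hmJ, fun hmI => ?_, fun k hk => ?_⟩
    · rcases hm with hm | hm
      · exact hm.2 hmJ
      · exact hm.2 hmI
    · by_contra hne
      have : k ∈ (I \ J) ∪ (J \ I) := by
        simp only [Set.mem_union, Set.mem_sdiff]
        tauto
      exact absurd (hmin k this) (by omega)
  · rintro ⟨m, hmJ, hmI, h⟩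
    refine ⟨fun e => hmI (e ▸ hmJ), m, Or.inr ⟨hmJ, hmI⟩, fun k hk => ?_, hmJ⟩
    by_contra hlt
    have := h k (by omega)
    simp only [Set.mem_union, Set.mem_sdiff] at hk
    tauto

theorem grlt_asymm {I J : Set ℕ} (h : GRlt I J) (h' : GRlt J I) : False := by
  obtain ⟨m, hm, hm', h₁⟩ := grlt_iff.1 h
  obtain ⟨n, hn, hn', h₂⟩ := grlt_iff.1 h'
  rcases lt_trichotomy m n with hlt | rfl | hlt
  · exact hm' ((h₂ m hlt).1 hm)
  · exact hm' hn
  · exact hn' ((h₁ n hlt).1 hn)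

theorem grle_antisymm {I J : Set ℕ} (h : GRle I J) (h' : GRle J I) : I = J := by
  rcases h with h | h
  · exact h
  rcases h' with h' | h'
  · exact h'.symm
  exact (grlt_asymm h h').elim

theorem grlt_trans {I J K : Set ℕ} (h : GRlt I J) (h' : GRlt J K) : GRlt I K := by
  obtain ⟨m, hm, hm', h₁⟩ := grlt_iff.1 h
  obtain ⟨n, hn, hn', h₂⟩ := grlt_iff.1 h'
  rw [grlt_iff]
  rcases lt_trichotomy m n with hlt | rfl | hlt
  · exact ⟨m, (h₂ m hlt).1 hm, hm', fun k hk => (h₁ k hk).trans (h₂ k (hk.trans hlt))⟩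
  · exact (hn' hm).elim
  · exact ⟨n, hn, fun hI => hn' ((h₁ n hlt).1 hI),
      fun k hk => (h₁ k (hk.trans hlt)).trans (h₂ k hk)⟩

theorem grle_trans {I J K : Set ℕ} (h : GRle I J) (h' : GRle J K) : GRle I K := by
  rcases h with rfl | h
  · exact h'
  rcases h' with rfl | h'
  · exact Or.inr h
  exact Or.inr (grlt_trans h h')

theorem grle_total (I J : Set ℕ) : GRle I J ∨ GRle J I := by
  classical
  by_cases hIJ : I = J
  · exact Or.inl (Or.inl hIJ)
  have hex : ∃ m, ¬ (m ∈ I ↔ m ∈ J) := by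
    by_contra! h
    exact hIJ (Set.ext h)
  have hspec := Nat.find_spec hex
  have hmin : ∀ k < Nat.find hex, k ∈ I ↔ k ∈ J :=
    fun k hk => not_not.1 (Nat.find_min hex hk)
  by_cases hI : Nat.find hex ∈ I
  · exact Or.inr (Or.inr (grlt_iff.2 ⟨_, hI, by tauto, fun k hk => (hmin k hk).symm⟩))
  · exact Or.inl (Or.inr (grlt_iff.2 ⟨_, by tauto, hI, hmin⟩))

theorem exists_grle_max_of_finite {F : Set (Set ℕ)} (hF : F.Finite) (hne : F.Nonempty) :
    ∃ S ∈ F, ∀ S' ∈ F, GRle S' S := by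
  induction F, hF using Set.Finite.induction_on with
  | empty => exact (Set.not_nonempty_empty hne).elim
  | @insert a F _ _ ih =>
    rcases F.eq_empty_or_nonempty with rfl | hF
    · exact ⟨a, by simp, by simp [GRle]⟩
    obtain ⟨S, hS, hmax⟩ := ih hF
    rcases grle_total a S with h | h
    · refine ⟨S, Or.inr hS, ?_⟩
      rintro S' (rfl | hS')
      · exact h
      · exact hmax S' hS'
    · refine ⟨a, Or.inl rfl, ?_⟩
      rintro S' (rfl | hS')
      · exact Or.inl rfl
      · exact grle_trans (hmax S' hS') h

theorem grle_of_union_singleton {I J : Set ℕ} {n : ℕ} (hI : n ∉ I) (hJ : n ∉ J)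
    (h : GRle (I ∪ {n}) (J ∪ {n})) : GRle I J := by
  rcases h with h | h
  · left
    ext k
    have := Set.ext_iff.1 h k
    by_cases hk : k = n
    · subst hk; tauto
    · simpa [hk] using this
  · right
    obtain ⟨m, hmJ, hmI, h⟩ := grlt_iff.1 h
    have hmn : m ≠ n := fun e => hmI (Or.inr e)
    refine grlt_iff.2 ⟨m, by simpa [hmn] using hmJ, fun hm => hmI (Or.inl hm), fun k hk => ?_⟩
    have := h k hk
    by_cases hk : k = n
    · subst hk; tauto
    · simpa [hk] using this

theorem grlt_union_singleton {I : Set ℕ} {n : ℕ} (hn : n ∉ I) : GRlt I (I ∪ {n}) :=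
  grlt_iff.2 ⟨n, Or.inr rfl, hn, fun k hk => by simp [hk.ne]⟩

theorem range_fin_succ_eq_union_last {α : Type*} {n : ℕ} (f : Fin (n + 1) → α) :
    Set.range f = (Set.range fun i : Fin n => f i.castSucc) ∪ {f (Fin.last n)} := by
  ext k
  simp [Fin.exists_fin_succ', eq_comm (b := k), or_comm]

section

variable {Λ : Type*} [Ring Λ] {M : Type*} [AddCommGroup M] [Module Λ M]

theorem mlen_eq_toNat_length (h : IsFiniteLength Λ M) :
    mlen Λ M = (Module.length Λ M).toNat := by
  have hs := isFiniteLength_iff_exists_compositionSeries.1 h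
  rw [mlen, dif_pos hs, ← Module.length_compositionSeries _ hs.choose_spec.1 hs.choose_spec.2]
  rfl

theorem coe_mlen (h : IsFiniteLength Λ M) : (mlen Λ M : ℕ∞) = Module.length Λ M := by
  rw [mlen_eq_toNat_length h, ENat.natCast_toNat (Module.length_ne_top_iff.2 h)]

theorem IsFiniteLength.submodule (h : IsFiniteLength Λ M) (N : Submodule Λ M) :
    IsFiniteLength Λ N :=
  h.of_injective N.subtype_injective

theorem mlen_eq_of_linearEquiv (h : IsFiniteLength Λ M) {N : Type*} [AddCommGroup N]
    [Module Λ N] (e : M ≃ₗ[Λ] N) : mlen Λ M = mlen Λ N := by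
  rw [mlen_eq_toNat_length h, mlen_eq_toNat_length (e.isFiniteLength h), e.length_eq]

theorem mlen_lt (h : IsFiniteLength Λ M) {N : Submodule Λ M} (hN : N ≠ ⊤) :
    mlen Λ N < mlen Λ M := by
  have ⟨_, _⟩ := isFiniteLength_iff_isNoetherian_isArtinian.1 h
  have := Submodule.length_lt hN
  rwa [← coe_mlen h, ← coe_mlen (h.submodule N), Nat.cast_lt] at this

theorem mlen_of_eq_top (h : IsFiniteLength Λ M) {N : Submodule Λ M} (hN : N = ⊤) :
    mlen Λ N = mlen Λ M := by
  subst hN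
  exact mlen_eq_of_linearEquiv (h.submodule ⊤) Submodule.topEquiv

theorem IsIndecomposableModule.of_linearEquiv {N : Type*} [AddCommGroup N] [Module Λ N]
    (h : IsIndecomposableModule Λ M) (e : M ≃ₗ[Λ] N) : IsIndecomposableModule Λ N := by
  let f := Submodule.orderIsoMapComap e
  refine ⟨fun h0 => h.1 (f.injective (by simpa using h0)), ?_⟩
  rintro ⟨A, B, hA, hB, hAB⟩
  refine h.2 ⟨f.symm A, f.symm B, ?_, ?_, f.symm.isCompl hAB⟩
  · simpa only [ne_eq, map_eq_bot_iff] using hA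
  · simpa only [ne_eq, map_eq_bot_iff] using hB

theorem IsIndecomposableModule.top (h : IsIndecomposableModule Λ M) :
    IsIndecomposableModule Λ (⊤ : Submodule Λ M) :=
  h.of_linearEquiv Submodule.topEquiv.symm

theorem IsSimpleModule.isIndecomposableModule [IsSimpleModule Λ M] :
    IsIndecomposableModule Λ M := by
  refine ⟨top_ne_bot, ?_⟩
  rintro ⟨A, B, hA, hB, hAB⟩
  have hA' := (eq_bot_or_eq_top A).resolve_left hA
  have hB' := (eq_bot_or_eq_top B).resolve_left hB
  subst hA' hB'
  exact hA (by simpa using hAB.inf_eq_bot)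

theorem range_mlen_mem_grChainSets {t : ℕ} {c : Fin (t + 1) → Submodule Λ M}
    (h : IsFiniteLength Λ M) (hc : StrictMono c) (hi : ∀ i, IsIndecomposableModule Λ (c i))
    {T : Submodule Λ M} (hT : ∀ i, c i ≤ T) :
    (Set.range fun i => mlen Λ (c i)) ∈ grChainSets Λ T := by
  refine ⟨t, fun i => (c i).submoduleOf T, fun i j hij => ?_, fun i => ?_, ?_⟩
  · refine lt_of_le_of_ne (Submodule.comap_mono (hc hij).le) fun he => (hc hij).ne ?_
    have := congrArg (Submodule.map T.subtype) he
    simpa [Submodule.submoduleOf, Submodule.map_comap_subtype, hT] using this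
  · exact (hi i).of_linearEquiv (Submodule.submoduleOfEquivOfLe (hT i)).symm
  · congr 1
    funext i
    exact mlen_eq_of_linearEquiv (h.submodule _) (Submodule.submoduleOfEquivOfLe (hT i)).symm

theorem union_mlen_mem_grChainSets (h : IsFiniteLength Λ M) (hM : IsIndecomposableModule Λ M)
    {T : Submodule Λ M} (hT : T ≠ ⊤) {R : Set ℕ} (hR : R ∈ grChainSets Λ T) :
    R ∪ {mlen Λ M} ∈ grChainSets Λ M := by
  obtain ⟨t, c, hc, hi, rfl⟩ := hR
  let d : Fin (t + 1) → Submodule Λ M := fun i => (c i).map T.subtype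
  have hd : StrictMono d := (Submodule.map_strictMono_of_injective T.subtype_injective).comp hc
  have hlt : ∀ i, d i < ⊤ := fun i => (Submodule.map_subtype_le T (c i)).trans_lt hT.lt_top
  obtain ⟨e, he, hlast⟩ : ∃ e : Fin (t + 2) → Submodule Λ M,
      (∀ i : Fin (t + 1), e i.castSucc = d i) ∧ e (Fin.last (t + 1)) = ⊤ :=
    ⟨Fin.snoc (α := fun _ => Submodule Λ M) d ⊤, fun i => Fin.snoc_castSucc .., Fin.snoc_last ..⟩
  refine ⟨t + 1, e, Fin.strictMono_iff_lt_succ.2 fun i => ?_, fun i => ?_, ?_⟩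
  · induction i using Fin.lastCases with
    | last =>
      rw [Fin.succ_last, he, hlast]
      exact hlt _
    | cast i =>
      rw [Fin.succ_castSucc, he, he]
      exact hd Fin.castSucc_lt_succ
  · induction i using Fin.lastCases with
    | last =>
      rw [hlast]
      exact hM.top
    | cast i =>
      rw [he]
      exact (hi i).of_linearEquiv (T.equivSubtypeMap (c i))
  · rw [range_fin_succ_eq_union_last (fun i => mlen Λ (e i)), mlen_of_eq_top h hlast]
    congr 2
    funext i
    rw [he]
    exact mlen_eq_of_linearEquiv ((h.submodule T).submodule _) (T.equivSubtypeMap (c i))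

theorem subset_Iic_mlen_of_mem_grChainSets (h : IsFiniteLength Λ M) {R : Set ℕ}
    (hR : R ∈ grChainSets Λ M) : R ⊆ Set.Iic (mlen Λ M) := by
  obtain ⟨t, c, -, -, rfl⟩ := hR
  rintro _ ⟨i, rfl⟩
  by_cases hc : c i = ⊤
  · exact (mlen_of_eq_top h hc).le
  · exact (mlen_lt h hc).le

theorem mlen_notMem_of_mem_grChainSets (h : IsFiniteLength Λ M) {T : Submodule Λ M} (hT : T ≠ ⊤)
    {R : Set ℕ} (hR : R ∈ grChainSets Λ T) : mlen Λ M ∉ R := fun hm =>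
  (mlen_lt h hT).not_ge (subset_Iic_mlen_of_mem_grChainSets (h.submodule T) hR hm)

theorem IsIndecomposableModule.singleton_mlen_mem_grChainSets (h : IsFiniteLength Λ M)
    (hM : IsIndecomposableModule Λ M) : {mlen Λ M} ∈ grChainSets Λ M :=
  ⟨0, fun _ => ⊤, fun i j hij => by omega, fun _ => hM.top, by
    rw [Set.range_const, mlen_of_eq_top h rfl]⟩

theorem grMeasure_eq_of_max {S : Set ℕ} (hS : S ∈ grChainSets Λ M)
    (hmax : ∀ S' ∈ grChainSets Λ M, GRle S' S) : grMeasure Λ M = S := by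
  have hex : ∃ S, S ∈ grChainSets Λ M ∧ ∀ S' ∈ grChainSets Λ M, GRle S' S := ⟨S, hS, hmax⟩
  rw [grMeasure, dif_pos hex]
  exact grle_antisymm (hmax _ hex.choose_spec.1) (hex.choose_spec.2 _ hS)

end

/-- Let `Λ` be a ring and `M` an indecomposable `Λ`-module of finite length at
least `2`.  Then `M` has a Gabriel–Roiter submodule: there is an
indecomposable proper submodule `T` of `M` with `μ(M) = μ(T) ∪ {|M|}`. -/
theorem exists_gr_submodule (Λ : Type*) [Ring Λ] (M : Type*) [AddCommGroup M]
    [Module Λ M] (hfl : IsFiniteLength Λ M) (hlen : 2 ≤ mlen Λ M)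
    (hind : IsIndecomposableModule Λ M) :
    ∃ T : Submodule Λ M, T ≠ ⊤ ∧ IsIndecomposableModule Λ T ∧
      grMeasure Λ M = grMeasure Λ T ∪ {mlen Λ M} := by
  obtain ⟨S, hS, hmax⟩ := exists_grle_max_of_finite
    ((Set.finite_Iic (mlen Λ M)).finite_subsets.subset fun R hR =>
      subset_Iic_mlen_of_mem_grChainSets hfl hR)
    ⟨_, hind.singleton_mlen_mem_grChainSets hfl⟩
  have hmeas := grMeasure_eq_of_max hS hmax
  have hnlt : ∀ {R}, R ∈ grChainSets Λ M → ¬ GRlt S R := fun hR hlt => by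
    rcases hmax _ hR with rfl | h
    · exact hlt.1 rfl
    · exact grlt_asymm hlt h
  obtain ⟨t, c, hc, hi, hSc⟩ := hS
  have hlast : c (Fin.last t) = ⊤ := by
    by_contra hne
    have hR := range_mlen_mem_grChainSets hfl hc hi fun i => hc.monotone (Fin.le_last i)
    rw [← hSc] at hR
    exact hnlt (union_mlen_mem_grChainSets hfl hind hne hR)
      (grlt_union_singleton (mlen_notMem_of_mem_grChainSets hfl hne hR))
  cases t with
  | zero =>
    exfalso
    have hS' : S = {mlen Λ M} := by
      rw [hSc, range_fin_succ_eq_union_last, mlen_of_eq_top hfl hlast, Set.range_eq_empty,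
        Set.empty_union]
    have ⟨_, _⟩ := isFiniteLength_iff_isNoetherian_isArtinian.1 hfl
    have : Nontrivial (Submodule Λ M) := ⟨_, _, hind.1⟩
    obtain ⟨A, hA⟩ := IsAtomic.exists_atom (Submodule Λ M)
    have hsimple : IsSimpleModule Λ A := isSimpleModule_iff_isAtom.2 hA
    have hA1 : mlen Λ A = 1 := by
      rw [mlen_eq_toNat_length (hfl.submodule A), Module.length_eq_one]
      rfl
    have hAtop : A ≠ ⊤ := by
      rintro rfl
      rw [mlen_of_eq_top hfl rfl] at hA1
      omega
    have hAm := union_mlen_mem_grChainSets hfl hind hAtop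
      (IsSimpleModule.isIndecomposableModule.singleton_mlen_mem_grChainSets (hfl.submodule A))
    refine hnlt hAm ?_
    rw [hS', Set.union_comm]
    exact grlt_union_singleton (mlen_lt hfl hAtop).ne
  | succ t =>
    let T := c (Fin.last t).castSucc
    have hT : T ≠ ⊤ := by
      rw [← hlast]
      exact (hc (Fin.castSucc_lt_last _)).ne
    refine ⟨T, hT, hi _, ?_⟩
    have hR : (Set.range fun i : Fin (t + 1) => mlen Λ (c i.castSucc)) ∈ grChainSets Λ T :=
      range_mlen_mem_grChainSets (c := fun i => c i.castSucc) hfl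
        (hc.comp Fin.strictMono_castSucc) (fun i => hi _)
        fun i => hc.monotone (Fin.castSucc_le_castSucc_iff.2 (Fin.le_last i))
    have hSR : S = (Set.range fun i : Fin (t + 1) => mlen Λ (c i.castSucc)) ∪ {mlen Λ M} := by
      rw [hSc, range_fin_succ_eq_union_last, mlen_of_eq_top hfl hlast]
    rw [hmeas, grMeasure_eq_of_max hR, hSR]
    intro R' hR'
    refine grle_of_union_singleton (mlen_notMem_of_mem_grChainSets hfl hT hR')
      (mlen_notMem_of_mem_grChainSets hfl hT hR) ?_
    rw [← hSR]
    exact hmax _ (union_mlen_mem_grChainSets hfl hind hT hR')
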